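/- arXiv:2507.00147 — 2 statements merged into one kernel-verified Lean document; each statement's English description precedes it below -/
import Mathlib

section
/- Let (c(n))_{n≥0} be the coefficient sequence of a quasimodular Eisenstein series such that c(n) is real for all n ≥ 1. Then there exists ε ∈ {−1, 0, 1} and a bound N such that for every prime p > N one has sgn(c(p)) = ε, where sgn denotes the sign function with sgn(0) = 0. -/
open Complex Filter Finset

noncomputable section

/-- `a` is the Fourier coefficient sequence of the cusp form `f` of weight `k` for `SL₂(ℤ)`:
`f(τ) = Σ_{n ≥ 1} a(n) e^{2πinτ}` (with `a 0 = 0`). -/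
def CuspFormCoeffs (k : ℤ) (f : CuspForm (CongruenceSubgroup.Gamma 1) k) (a : ℕ → ℂ) : Prop :=
  a 0 = 0 ∧ ∀ τ : UpperHalfPlane,
    Summable (fun n : ℕ => a n * Complex.exp (2 * (Real.pi : ℂ) * Complex.I * (n : ℂ) * (τ : ℂ))) ∧
    f τ = ∑' n : ℕ, a n * Complex.exp (2 * (Real.pi : ℂ) * Complex.I * (n : ℂ) * (τ : ℂ))

/-- `S` is the coefficient sequence of a quasimodular cusp form for `SL₂(ℤ)`, i.e. of a linear
combination of cusp forms and their iterated derivatives under `D = q d/dq`. -/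
def IsQuasiCuspCoeff (S : ℕ → ℂ) : Prop :=
  ∃ (m : ℕ) (A : Fin m → ℂ) (j : Fin m → ℕ) (k : Fin m → ℤ)
    (f : ∀ i, CuspForm (CongruenceSubgroup.Gamma 1) (k i)) (a : Fin m → ℕ → ℂ),
    (∀ i, CuspFormCoeffs (k i) (f i) (a i)) ∧ S 0 = 0 ∧
      ∀ n : ℕ, 1 ≤ n → S n = ∑ i, A i * (n : ℂ) ^ (j i) * a i n

/-- `E` is the coefficient sequence of a quasimodular Eisenstein series, i.e. of a linear
combination of the Eisenstein series `G_k` and their iterated derivatives under `D = q d/dq`. -/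
def IsQuasiEisCoeff (E : ℕ → ℂ) : Prop :=
  ∃ (s : Finset (ℕ × ℕ)) (α : ℕ × ℕ → ℂ),
    (∀ p ∈ s, 2 ≤ p.1 ∧ Even p.1) ∧
    E 0 = ∑ p ∈ s.filter (fun p => p.2 = 0), α p * (bernoulli p.1 : ℂ) / (2 * (p.1 : ℂ)) ∧
    ∀ n : ℕ, 1 ≤ n →
      E n = ∑ p ∈ s, α p * (n : ℂ) ^ p.2 * ((ArithmeticFunction.sigma (p.1 - 1) n : ℕ) : ℂ)

/-- A nonzero real polynomial with nonnegative leading coefficient is eventually positive. -/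
theorem eventually_eval_pos {P : Polynomial ℝ} (hP : P ≠ 0) (hlead : 0 ≤ P.leadingCoeff) :
    ∀ᶠ x : ℝ in atTop, 0 < P.eval x := by
  have hdeg : 0 < (P * Polynomial.X).degree := by
    rw [← Polynomial.natDegree_pos_iff_degree_pos, Polynomial.natDegree_mul_X hP]
    exact Nat.succ_pos _
  have htend := (P * Polynomial.X).tendsto_atTop_of_leadingCoeff_nonneg hdeg
    (by rwa [Polynomial.leadingCoeff_mul_X])
  filter_upwards [htend.eventually_gt_atTop 0, eventually_gt_atTop 0] with x hx hx0
  rw [Polynomial.eval_mul, Polynomial.eval_X] at hx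
  exact pos_of_mul_pos_left hx hx0.le

/-- The sign of a real polynomial is eventually constant. -/
theorem exists_eventually_sign_eval (P : Polynomial ℝ) :
    ∃ e : ℝ, e ∈ ({-1, 0, 1} : Set ℝ) ∧ ∀ᶠ x : ℝ in atTop, Real.sign (P.eval x) = e := by
  rcases eq_or_ne P 0 with rfl | hP
  · exact ⟨0, by simp, by simp⟩
  rcases le_total 0 P.leadingCoeff with h | h
  · exact ⟨1, by simp, (eventually_eval_pos hP h).mono fun x hx => Real.sign_of_pos hx⟩
  · refine ⟨-1, by simp, (eventually_eval_pos (neg_ne_zero.mpr hP) ?_).mono fun x hx => ?_⟩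
    · simpa using h
    · exact Real.sign_of_neg (by simpa using hx)

/-- On primes, the real part of a quasimodular Eisenstein coefficient is polynomial. -/
theorem IsQuasiEisCoeff.exists_polynomial {c : ℕ → ℂ} (hc : IsQuasiEisCoeff c) :
    ∃ P : Polynomial ℝ, ∀ p : ℕ, p.Prime → (c p).re = P.eval (p : ℝ) := by
  obtain ⟨s, α, -, -, hs⟩ := hc
  refine ⟨∑ q ∈ s, Polynomial.C (α q).re *
    (Polynomial.X ^ q.2 * (Polynomial.X ^ (q.1 - 1) + 1)), fun p hp => ?_⟩
  rw [hs p hp.one_le, Complex.re_sum, Polynomial.eval_finsetSum]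
  refine Finset.sum_congr rfl fun q _ => ?_
  have hsigma : ArithmeticFunction.sigma (q.1 - 1) p = p ^ (q.1 - 1) + 1 := by
    rw [ArithmeticFunction.sigma_apply, hp.sum_divisors]
    simp
  rw [hsigma, mul_assoc, ← Nat.cast_pow, ← Nat.cast_mul, ← Complex.ofReal_natCast, Complex.re_mul_ofReal]
  simp

/-- Lemma 4.1: the coefficients of a quasimodular Eisenstein series with real coefficients
have a constant sign `ε ∈ {-1, 0, 1}` at all sufficiently large primes. -/
theorem eisenstein_eventual_sign (c : ℕ → ℂ) (hc : IsQuasiEisCoeff c)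
    (hreal : ∀ n : ℕ, 1 ≤ n → (c n).im = 0) :
    ∃ e : ℝ, e ∈ ({-1, 0, 1} : Set ℝ) ∧ ∃ N : ℕ,
      ∀ p : ℕ, p.Prime → N < p → Real.sign ((c p).re) = e := by
  obtain ⟨P, hP⟩ := hc.exists_polynomial
  obtain ⟨e, he, hsign⟩ := exists_eventually_sign_eval P
  obtain ⟨N, hN⟩ := eventually_atTop.mp (tendsto_natCast_atTop_atTop.eventually hsign)
  exact ⟨e, he, N, fun p hp hNp => by rw [hP p hp]; exact hN p hNp.le⟩
end
end

section
/- Let a ≥ 1 be a real number and let c be a real-valued function defined on the natural numbers such that: (i) there exists C > 0 with |c(p)| ≤ C p^{a−1} for every prime p; (ii) Σ_{p ≤ x, p prime} c(p) = o(x^a / log x) as x → ∞; and (iii) there exist δ > 0 and x_0 such that Σ_{p ≤ x, p prime} c(p)² ≥ δ x^{2a−1}/log x for all x ≥ x_0. Then c changes sign at infinitely many primes: for every N there exist primes p, q > N with c(p) > 0 and c(q) < 0. -/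
open Complex Filter Finset

noncomputable section

/-- If `|c(p)| ≤ C p^{a-1}` at primes and `Σ_{p ≤ x} c(p) = o(x^a / log x)`, while
`Σ_{p ≤ x} c(p)² ≫ x^{2a-1} / log x`, then `c` takes negative values at arbitrarily large primes. -/
theorem exists_prime_gt_and_neg (a : ℝ) (ha : 1 ≤ a) (c : ℕ → ℝ)
    (hbound : ∃ C : ℝ, 0 < C ∧ ∀ p : ℕ, p.Prime → |c p| ≤ C * (p : ℝ) ^ (a - 1))
    (hlittleo : Tendsto
      (fun x : ℝ => |∑ p ∈ (⌊x⌋₊ + 1).primesBelow, c p| * Real.log x / x ^ a)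
      atTop (nhds 0))
    (hlower : ∃ δ : ℝ, 0 < δ ∧ ∃ x₀ : ℝ, ∀ x : ℝ, x₀ ≤ x →
      δ * x ^ (2 * a - 1) / Real.log x ≤ ∑ p ∈ (⌊x⌋₊ + 1).primesBelow, (c p) ^ 2)
    (N : ℕ) : ∃ q : ℕ, q.Prime ∧ N < q ∧ c q < 0 := by
  by_contra! hnonneg
  obtain ⟨C, hC, hb⟩ := hbound
  obtain ⟨δ, hδ, x₀, hl⟩ := hlower
  set K : ℝ := ∑ p ∈ range (N + 1), 2 * |c p|
  have habs (x : ℝ) : ∑ p ∈ (⌊x⌋₊ + 1).primesBelow, |c p| ≤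
      |∑ p ∈ (⌊x⌋₊ + 1).primesBelow, c p| + K := by
    set s := (⌊x⌋₊ + 1).primesBelow
    have h : ∑ p ∈ s, (|c p| - c p) ≤ K := calc
      ∑ p ∈ s, (|c p| - c p) ≤ ∑ p ∈ s, if p ∈ range (N + 1) then 2 * |c p| else 0 := by
        refine sum_le_sum fun p hp ↦ ?_
        split_ifs with h
        · linarith [neg_abs_le (c p)]
        · have := hnonneg p (Nat.prime_of_mem_primesBelow hp) (by simpa using h)
          simp [abs_of_nonneg this]
      _ = ∑ p ∈ s ∩ range (N + 1), 2 * |c p| := sum_ite_mem _ _ _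
      _ ≤ K := sum_le_sum_of_subset_of_nonneg inter_subset_right fun _ _ _ ↦ by positivity
    rw [sum_sub_distrib] at h
    linarith [le_abs_self (∑ p ∈ s, c p)]
  have hlog : Tendsto (fun x : ℝ ↦ Real.log x / x ^ a) atTop (nhds 0) :=
    (isLittleO_log_rpow_atTop (by linarith)).tendsto_div_nhds_zero
  have hlim := (hlittleo.add (hlog.const_mul K)).const_mul C
  simp only [mul_zero, add_zero] at hlim
  obtain ⟨x, hlt, hx₀, hx⟩ :=
    ((hlim.eventually_lt_const hδ).and
      ((eventually_ge_atTop x₀).and (eventually_gt_atTop 1))).exists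
  have hx0 : 0 < x := by linarith
  have hlogx : 0 < Real.log x := Real.log_pos hx
  have hsq : ∑ p ∈ (⌊x⌋₊ + 1).primesBelow, (c p) ^ 2 ≤
      C * x ^ (a - 1) * ∑ p ∈ (⌊x⌋₊ + 1).primesBelow, |c p| := by
    rw [mul_sum]
    refine sum_le_sum fun p hp ↦ ?_
    have hpx : (p : ℝ) ≤ x :=
      (Nat.le_floor_iff hx0.le).1 (Nat.lt_succ_iff.1 (Nat.lt_of_mem_primesBelow hp))
    rw [← sq_abs, sq]
    refine mul_le_mul_of_nonneg_right
      ((hb p (Nat.prime_of_mem_primesBelow hp)).trans ?_) (abs_nonneg _)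
    gcongr
  have hmain : δ * x ^ (2 * a - 1) / Real.log x ≤
      C * x ^ (a - 1) * (|∑ p ∈ (⌊x⌋₊ + 1).primesBelow, c p| + K) :=
    (hl x hx₀).trans (hsq.trans (mul_le_mul_of_nonneg_left (habs x) (by positivity)))
  rw [show 2 * a - 1 = a + (a - 1) by ring, Real.rpow_add hx0, div_le_iff₀ hlogx] at hmain
  have hxa : 0 < x ^ a := by positivity
  have hxa' : 0 < x ^ (a - 1) := by positivity
  refine hlt.not_ge ?_
  rw [← mul_div_assoc K, ← add_div, ← mul_div_assoc, le_div_iff₀ hxa]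
  refine le_of_mul_le_mul_right ?_ hxa'
  linarith

/-- The abstract sign-change principle underlying Lemma 3.1: if `c` is real-valued with
`|c(p)| ≤ C p^{a-1}` at primes, `Σ_{p ≤ x} c(p) = o(x^a / log x)`, and
`Σ_{p ≤ x} c(p)² ≫ x^{2a-1} / log x`, then `c` changes sign at infinitely many primes. -/
theorem sign_change_principle (a : ℝ) (ha : 1 ≤ a) (c : ℕ → ℝ)
    (hbound : ∃ C : ℝ, 0 < C ∧ ∀ p : ℕ, p.Prime → |c p| ≤ C * (p : ℝ) ^ (a - 1))
    (hlittleo : Tendsto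
      (fun x : ℝ => |∑ p ∈ (⌊x⌋₊ + 1).primesBelow, c p| * Real.log x / x ^ a)
      atTop (nhds 0))
    (hlower : ∃ δ : ℝ, 0 < δ ∧ ∃ x₀ : ℝ, ∀ x : ℝ, x₀ ≤ x →
      δ * x ^ (2 * a - 1) / Real.log x ≤ ∑ p ∈ (⌊x⌋₊ + 1).primesBelow, (c p) ^ 2) :
    ∀ N : ℕ, ∃ p q : ℕ, p.Prime ∧ q.Prime ∧ N < p ∧ N < q ∧ 0 < c p ∧ c q < 0 := by
  intro N
  obtain ⟨q, hq, hNq, hcq⟩ := exists_prime_gt_and_neg a ha c hbound hlittleo hlower N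
  obtain ⟨p, hp, hNp, hcp⟩ := exists_prime_gt_and_neg a ha (fun n ↦ -c n)
    (by simpa only [abs_neg] using hbound)
    (by simpa only [sum_neg_distrib, abs_neg] using hlittleo)
    (by simpa only [neg_sq] using hlower) N
  exact ⟨p, q, hp, hq, hNp, hNq, neg_neg_iff_pos.1 hcp, hcq⟩
end
end
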